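/- For every β with α < β < β*, the set {u ∈ C(K) : ℰ_β(u,u) < ∞} of continuous functions with finite energy is dense in C(K) with respect to the uniform norm. -/

import Mathlib

open MeasureTheory Filter Set
open scoped ENNReal NNReal Classical

noncomputable section

namespace SG

/-- The three vertices `p₀ = (0,0)`, `p₁ = (1,0)`, `p₂ = (1/2, √3/2)` viewed in `ℂ`. -/
def p : Fin 3 → ℂ := ![0, 1, 1/2 + (Real.sqrt 3 / 2) * Complex.I]

/-- The three contraction maps `fᵢ x = (x + pᵢ)/2`. -/
def f (i : Fin 3) (x : ℂ) : ℂ := (x + p i) / 2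

/-- `K` is the Sierpinski gasket: the (unique) nonempty compact set with
`K = f₀(K) ∪ f₁(K) ∪ f₂(K)`. -/
def IsSG (K : Set ℂ) : Prop :=
  K.Nonempty ∧ IsCompact K ∧ K = f 0 '' K ∪ f 1 '' K ∪ f 2 '' K

/-- `α = log 3 / log 2`. -/
def alpha : ℝ := Real.log 3 / Real.log 2

/-- `β* = log 5 / log 2`. -/
def betastar : ℝ := Real.log 5 / Real.log 2

/-- The normalized `α`-dimensional Hausdorff measure restricted to `K`. -/
def nu (K : Set ℂ) : Measure ℂ :=
  ((Measure.hausdorffMeasure alpha : Measure ℂ) K)⁻¹ •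
    (Measure.hausdorffMeasure alpha : Measure ℂ).restrict K

/-- `f_w` for a finite word `w` over `{0,1,2}` (empty word gives the identity). -/
def fwl : List (Fin 3) → ℂ → ℂ
  | [] => id
  | i :: t => f i ∘ fwl t

/-- `f_w` for a word `w ∈ W_n = {0,1,2}ⁿ`. -/
def fw {n : ℕ} (w : Fin n → Fin 3) : ℂ → ℂ := fwl (List.ofFn w)

/-- The cell `K_w = f_w(K)`. -/
def Kw (K : Set ℂ) {n : ℕ} (w : Fin n → Fin 3) : Set ℂ := fw w '' K

/-- Adjacency `w⁽¹⁾ ∼ₙ w⁽²⁾`: distinct words with intersecting cells. -/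
def Adj (K : Set ℂ) {n : ℕ} (w1 w2 : Fin n → Fin 3) : Prop :=
  w1 ≠ w2 ∧ (Kw K w1 ∩ Kw K w2).Nonempty

/-- `Pₙu(w) = ∫_K u(f_w(x)) ν(dx)`. -/
def P (K : Set ℂ) {n : ℕ} (u : ℂ → ℝ) (w : Fin n → Fin 3) : ℝ :=
  ∫ x, u (fw w x) ∂(nu K)

/-- `Aₙ(u)`: sum over unordered adjacent pairs in `W_n` of `(Pₙu(w⁽¹⁾) − Pₙu(w⁽²⁾))²`
(written as half the sum over ordered pairs). -/
def A (K : Set ℂ) (n : ℕ) (u : ℂ → ℝ) : ℝ :=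
  (1/2) * ∑ w1 : Fin n → Fin 3, ∑ w2 : Fin n → Fin 3,
    if Adj K w1 w2 then (P K u w1 - P K u w2)^2 else 0

/-- `ℰ_β(u,u) = Σ_{n≥1} 2^{(β−α)n} Aₙ(u)`, valued in `[0,∞]`. -/
def EE (K : Set ℂ) (β : ℝ) (u : ℂ → ℝ) : ℝ≥0∞ :=
  ∑' n : ℕ, ENNReal.ofReal ((2:ℝ) ^ ((β - alpha) * ((n:ℝ) + 1)) * A K (n+1) u)

section Geometry

/-- The first coordinate of `z` in the basis `(p 1, p 2)`. -/
def coordOne (z : ℂ) : ℝ := z.re - z.im / Real.sqrt 3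

/-- The second coordinate of `z` in the basis `(p 1, p 2)`. -/
def coordTwo (z : ℂ) : ℝ := 2 * z.im / Real.sqrt 3

lemma sqrt_three_ne_zero : Real.sqrt 3 ≠ 0 := by positivity

lemma coordOne_p (i : Fin 3) : coordOne (p i) = if i = 1 then 1 else 0 := by
  have h := sqrt_three_ne_zero
  fin_cases i <;> simp [coordOne, p]
  field_simp
  norm_num

lemma coordTwo_p (i : Fin 3) : coordTwo (p i) = if i = 2 then 1 else 0 := by
  have h := sqrt_three_ne_zero
  fin_cases i <;> simp [coordTwo, p]
  field_simp

lemma ext_coord {x y : ℂ} (h1 : coordOne x = coordOne y) (h2 : coordTwo x = coordTwo y) :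
    x = y := by
  have h := sqrt_three_ne_zero
  unfold coordOne coordTwo at *
  have him : x.im = y.im := by
    field_simp at h2
    exact h2
  refine Complex.ext ?_ him
  rw [him] at h1
  linarith

lemma coordOne_f (i : Fin 3) (x : ℂ) :
    coordOne (f i x) = (coordOne x + coordOne (p i)) / 2 := by
  simp only [coordOne, f, Complex.div_ofNat_re, Complex.div_ofNat_im, Complex.add_re,
    Complex.add_im]
  ring

lemma coordTwo_f (i : Fin 3) (x : ℂ) :
    coordTwo (f i x) = (coordTwo x + coordTwo (p i)) / 2 := by
  simp only [coordTwo, f, Complex.div_ofNat_im, Complex.add_im]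
  ring

lemma continuous_coordOne : Continuous coordOne := by
  unfold coordOne
  fun_prop

lemma continuous_coordTwo : Continuous coordTwo := by
  unfold coordTwo
  fun_prop

lemma p_injective : Function.Injective p := by
  intro i j h
  have h1 := congrArg coordOne h
  have h2 := congrArg coordTwo h
  rw [coordOne_p, coordOne_p] at h1
  rw [coordTwo_p, coordTwo_p] at h2
  fin_cases i <;> fin_cases j <;> simp at h1 h2 ⊢

lemma continuous_f (i : Fin 3) : Continuous (f i) := by
  unfold f
  fun_prop

lemma f_injective (i : Fin 3) : Function.Injective (f i) := by
  intro x y h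
  unfold f at h
  linear_combination 2 * h

lemma f_p_self (i : Fin 3) : f i (p i) = p i := by
  unfold f
  ring

lemma f_p_comm (i j : Fin 3) : f i (p j) = f j (p i) := by
  unfold f
  ring

lemma dist_f (i : Fin 3) (x y : ℂ) : dist (f i x) (f i y) = dist x y / 2 := by
  have : (x + p i) / 2 - (y + p i) / 2 = (x - y) / 2 := by ring
  rw [dist_eq_norm, dist_eq_norm, f, f, this, norm_div]
  norm_num

variable {K : Set ℂ}

lemma IsSG.f_mem (hK : IsSG K) (i : Fin 3) {x : ℂ} (hx : x ∈ K) : f i x ∈ K := by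
  rw [hK.2.2]
  fin_cases i
  · exact Or.inl (Or.inl ⟨x, hx, rfl⟩)
  · exact Or.inl (Or.inr ⟨x, hx, rfl⟩)
  · exact Or.inr ⟨x, hx, rfl⟩

lemma IsSG.exists_preimage (hK : IsSG K) {x : ℂ} (hx : x ∈ K) :
    ∃ q : Fin 3 × ℂ, q.2 ∈ K ∧ f q.1 q.2 = x := by
  rw [hK.2.2] at hx
  obtain (⟨y, hy, h⟩ | ⟨y, hy, h⟩) | ⟨y, hy, h⟩ := hx
  · exact ⟨(0, y), hy, h⟩
  · exact ⟨(1, y), hy, h⟩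
  · exact ⟨(2, y), hy, h⟩

lemma IsSG.p_mem (hK : IsSG K) (i : Fin 3) : p i ∈ K := by
  obtain ⟨x, hx, hmin⟩ := hK.2.1.exists_isMinOn hK.1
    (f := fun z => dist z (p i)) (by fun_prop)
  have h : dist x (p i) ≤ dist (f i x) (p i) := hmin (hK.f_mem i hx)
  have h' := dist_f i x (p i)
  rw [f_p_self] at h'
  have h0 : dist x (p i) = 0 := by
    have := dist_nonneg (x := x) (y := p i)
    linarith
  rwa [← dist_eq_zero.1 h0]

lemma IsSG.nonneg_of_affine (hK : IsSG K) {l : ℂ → ℝ} (hl : Continuous l)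
    (hf : ∀ i x, l (f i x) = (l x + l (p i)) / 2) (hp : ∀ i, 0 ≤ l (p i))
    {x : ℂ} (hx : x ∈ K) : 0 ≤ l x := by
  obtain ⟨z, hz, hmin⟩ := hK.2.1.exists_isMinOn hK.1 hl.continuousOn
  obtain ⟨⟨i, y⟩, hy, hq⟩ := hK.exists_preimage hz
  have h1 : l z ≤ l y := hmin hy
  have h2 : l z ≤ l x := hmin hx
  have h3 := hf i y
  have h4 := hp i
  simp only at hq
  rw [hq] at h3
  linarith

lemma IsSG.coordOne_nonneg (hK : IsSG K) {x : ℂ} (hx : x ∈ K) : 0 ≤ coordOne x :=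
  hK.nonneg_of_affine continuous_coordOne coordOne_f
    (fun i => by rw [coordOne_p]; split_ifs <;> norm_num) hx

lemma IsSG.coordTwo_nonneg (hK : IsSG K) {x : ℂ} (hx : x ∈ K) : 0 ≤ coordTwo x :=
  hK.nonneg_of_affine continuous_coordTwo coordTwo_f
    (fun i => by rw [coordTwo_p]; split_ifs <;> norm_num) hx

lemma IsSG.coord_add_le_one (hK : IsSG K) {x : ℂ} (hx : x ∈ K) :
    coordOne x + coordTwo x ≤ 1 := by
  have h : 0 ≤ 1 - (coordOne x + coordTwo x) := by
    refine hK.nonneg_of_affine (l := fun z => 1 - (coordOne z + coordTwo z)) ?_ ?_ ?_ hx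
    · exact continuous_const.sub (continuous_coordOne.add continuous_coordTwo)
    · intro i z
      simp only [coordOne_f, coordTwo_f]
      ring
    · intro i
      simp only [coordOne_p, coordTwo_p]
      fin_cases i <;> simp
  linarith

lemma IsSG.eq_p_of_f_eq (hK : IsSG K) {i j : Fin 3} (hij : i ≠ j) {x y : ℂ}
    (hx : x ∈ K) (hy : y ∈ K) (h : f i x = f j y) : x = p j := by
  have h1 := congrArg coordOne h
  have h2 := congrArg coordTwo h
  rw [coordOne_f, coordOne_f, coordOne_p, coordOne_p] at h1
  rw [coordTwo_f, coordTwo_f, coordTwo_p, coordTwo_p] at h2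
  have a1 := hK.coordOne_nonneg hx
  have a2 := hK.coordTwo_nonneg hx
  have a3 := hK.coord_add_le_one hx
  have b1 := hK.coordOne_nonneg hy
  have b2 := hK.coordTwo_nonneg hy
  have b3 := hK.coord_add_le_one hy
  apply ext_coord
  · rw [coordOne_p]
    fin_cases i <;> fin_cases j <;> simp at hij h1 h2 ⊢ <;> linarith
  · rw [coordTwo_p]
    fin_cases i <;> fin_cases j <;> simp at hij h1 h2 ⊢ <;> linarith

end Geometry

section Branch

variable {K : Set ℂ}

/-- A choice of `(i, y)` with `y ∈ K` and `f i y = x`, for `x ∈ K`. -/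
def branch (K : Set ℂ) (x : ℂ) : Fin 3 × ℂ :=
  Classical.epsilon fun q => q.2 ∈ K ∧ f q.1 q.2 = x

lemma IsSG.branch_mem (hK : IsSG K) {x : ℂ} (hx : x ∈ K) : (branch K x).2 ∈ K :=
  (Classical.epsilon_spec (hK.exists_preimage hx)).1

lemma IsSG.f_branch (hK : IsSG K) {x : ℂ} (hx : x ∈ K) :
    f (branch K x).1 (branch K x).2 = x :=
  (Classical.epsilon_spec (hK.exists_preimage hx)).2

lemma IsSG.branch_f (hK : IsSG K) (i : Fin 3) {x : ℂ} (hx : x ∈ K) :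
    branch K (f i x) = (i, x) ∨ ∃ j, j ≠ i ∧ x = p j ∧ branch K (f i x) = (j, p i) := by
  have hm := hK.branch_mem (hK.f_mem i hx)
  have hf := hK.f_branch (hK.f_mem i hx)
  generalize branch K (f i x) = q at hm hf ⊢
  obtain ⟨j, y⟩ := q
  simp only at hm hf
  by_cases hji : j = i
  · subst hji
    left
    rw [f_injective j hf]
  · right
    refine ⟨j, hji, hK.eq_p_of_f_eq (Ne.symm hji) hx hm hf.symm, ?_⟩
    rw [hK.eq_p_of_f_eq hji hm hx hf]

lemma IsSG.branch_p (hK : IsSG K) (i : Fin 3) : branch K (p i) = (i, p i) := by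
  have h := hK.branch_f i (hK.p_mem i)
  rw [f_p_self] at h
  obtain h | ⟨j, hji, hp, -⟩ := h
  · exact h
  · exact absurd (p_injective hp).symm hji

end Branch

section Harmonic

variable {K : Set ℂ}

/-- The vertex values on the cell `f i '' K` of the harmonic function with vertex values `v`. -/
def harmStep (i : Fin 3) (v : Fin 3 → ℝ) : Fin 3 → ℝ := fun j =>
  if j = i then v i else (v i + v j + (v 0 + v 1 + v 2)) / 5

lemma harmStep_self (i : Fin 3) (v : Fin 3 → ℝ) : harmStep i v i = v i := by
  simp [harmStep]

lemma harmStep_comm (i j : Fin 3) (v : Fin 3 → ℝ) : harmStep i v j = harmStep j v i := by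
  by_cases h : j = i
  · rw [h]
  · simp only [harmStep, h, Ne.symm h, if_false]
    ring

lemma harmStep_le (i j : Fin 3) {v : Fin 3 → ℝ} {b : ℝ} (h : ∀ j, v j ≤ b) :
    harmStep i v j ≤ b := by
  have h0 := h 0
  have h1 := h 1
  have h2 := h 2
  have hi := h i
  have hj := h j
  unfold harmStep
  split_ifs <;> linarith

lemma le_harmStep (i j : Fin 3) {v : Fin 3 → ℝ} {a : ℝ} (h : ∀ j, a ≤ v j) :
    a ≤ harmStep i v j := by
  have h0 := h 0
  have h1 := h 1
  have h2 := h 2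
  have hi := h i
  have hj := h j
  unfold harmStep
  split_ifs <;> linarith

lemma harmStep_osc (i : Fin 3) {v : Fin 3 → ℝ} {D : ℝ} (h : ∀ j k, v j - v k ≤ D)
    (j k : Fin 3) : harmStep i v j - harmStep i v k ≤ 3 / 5 * D := by
  have h01 := h 0 1
  have h02 := h 0 2
  have h10 := h 1 0
  have h12 := h 1 2
  have h20 := h 2 0
  have h21 := h 2 1
  fin_cases i <;> fin_cases j <;> fin_cases k <;> simp [harmStep] <;> linarith

/-- The graph energy of the vertex values `v`. -/
def vertexEnergy (v : Fin 3 → ℝ) : ℝ :=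
  (v 0 - v 1) ^ 2 + (v 1 - v 2) ^ 2 + (v 2 - v 0) ^ 2

lemma sum_vertexEnergy_harmStep (v : Fin 3 → ℝ) :
    ∑ i, vertexEnergy (harmStep i v) = 3 / 5 * vertexEnergy v := by
  simp [Fin.sum_univ_three, vertexEnergy, harmStep]
  ring

lemma sq_sub_le_vertexEnergy (v : Fin 3 → ℝ) (j k : Fin 3) :
    (v j - v k) ^ 2 ≤ vertexEnergy v := by
  unfold vertexEnergy
  fin_cases j <;> fin_cases k <;> simp <;>
    nlinarith [sq_nonneg (v 0 - v 1), sq_nonneg (v 1 - v 2), sq_nonneg (v 2 - v 0)]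

/-- The vertex values, on the `n`-cell containing `x` picked out by `branch`, of the harmonic
function with vertex values `v`. -/
def harmSeq (K : Set ℂ) : ℕ → (Fin 3 → ℝ) → ℂ → Fin 3 → ℝ
  | 0, v, _ => v
  | n + 1, v, x => harmSeq K n (harmStep (branch K x).1 v) (branch K x).2

/-- The harmonic function on the gasket with vertex values `v`. -/
def harm (K : Set ℂ) (v : Fin 3 → ℝ) (x : ℂ) : ℝ :=
  limUnder atTop fun n => harmSeq K n v x 0

lemma harmSeq_le (n : ℕ) {v : Fin 3 → ℝ} {b : ℝ} (h : ∀ j, v j ≤ b) (x : ℂ) (j : Fin 3) :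
    harmSeq K n v x j ≤ b := by
  induction n generalizing v x with
  | zero => exact h j
  | succ n ih => exact ih (fun j => harmStep_le _ j h) _

lemma le_harmSeq (n : ℕ) {v : Fin 3 → ℝ} {a : ℝ} (h : ∀ j, a ≤ v j) (x : ℂ) (j : Fin 3) :
    a ≤ harmSeq K n v x j := by
  induction n generalizing v x with
  | zero => exact h j
  | succ n ih => exact ih (fun j => le_harmStep _ j h) _

lemma dist_harmSeq_succ_le (n : ℕ) {v : Fin 3 → ℝ} {D : ℝ} (h : ∀ j k, v j - v k ≤ D) (x : ℂ) :
    dist (harmSeq K n v x 0) (harmSeq K (n + 1) v x 0) ≤ D * (3 / 5) ^ n := by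
  induction n generalizing v x D with
  | zero =>
    simp only [harmSeq, Real.dist_eq, pow_zero, mul_one, abs_le]
    have h1 := harmStep_le (branch K x).1 0 (v := v) (b := v 0 + D)
      (fun j => by linarith [h j 0])
    have h2 := le_harmStep (branch K x).1 0 (v := v) (a := v 0 - D)
      (fun j => by linarith [h 0 j])
    constructor <;> linarith
  | succ n ih =>
    have := ih (harmStep_osc (branch K x).1 h) (branch K x).2
    rw [harmSeq, harmSeq]
    refine this.trans (le_of_eq ?_)
    ring

lemma exists_osc_bound (v : Fin 3 → ℝ) : ∃ D, ∀ j k, v j - v k ≤ D := by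
  refine ⟨Real.sqrt (vertexEnergy v), fun j k => ?_⟩
  exact Real.le_sqrt_of_sq_le (sq_sub_le_vertexEnergy v j k)

lemma tendsto_harmSeq (v : Fin 3 → ℝ) (x : ℂ) :
    Tendsto (fun n => harmSeq K n v x 0) atTop (nhds (harm K v x)) := by
  obtain ⟨D, hD⟩ := exists_osc_bound v
  exact (cauchySeq_of_le_geometric (3 / 5) D (by norm_num)
    (fun n => dist_harmSeq_succ_le n hD x)).tendsto_limUnder

lemma harm_eq_branch (v : Fin 3 → ℝ) (x : ℂ) :
    harm K v x = harm K (harmStep (branch K x).1 v) (branch K x).2 :=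
  tendsto_nhds_unique ((tendsto_add_atTop_iff_nat 1).2 (tendsto_harmSeq v x))
    (tendsto_harmSeq _ _)

lemma harm_le {v : Fin 3 → ℝ} {b : ℝ} (h : ∀ j, v j ≤ b) (x : ℂ) : harm K v x ≤ b :=
  le_of_tendsto' (tendsto_harmSeq v x) fun n => harmSeq_le n h x 0

lemma le_harm {v : Fin 3 → ℝ} {a : ℝ} (h : ∀ j, a ≤ v j) (x : ℂ) : a ≤ harm K v x :=
  ge_of_tendsto' (tendsto_harmSeq v x) fun n => le_harmSeq n h x 0

lemma IsSG.harm_p (hK : IsSG K) (v : Fin 3 → ℝ) (i : Fin 3) : harm K v (p i) = v i := by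
  have key : ∀ (n : ℕ) (v : Fin 3 → ℝ) (D : ℝ), (∀ j k, v j - v k ≤ D) →
      |harm K v (p i) - v i| ≤ D * (3 / 5) ^ n := by
    intro n
    induction n with
    | zero =>
      intro v D h
      have h1 := harm_le (K := K) (v := v) (b := v i + D) (fun j => by linarith [h j i]) (p i)
      have h2 := le_harm (K := K) (v := v) (a := v i - D) (fun j => by linarith [h i j]) (p i)
      rw [pow_zero, mul_one, abs_le]
      constructor <;> linarith
    | succ n ih =>
      intro v D h
      have := ih _ _ (harmStep_osc i h)
      rw [harmStep_self] at this
      rw [harm_eq_branch, hK.branch_p]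
      refine this.trans (le_of_eq ?_)
      ring
  obtain ⟨D, hD⟩ := exists_osc_bound v
  have hlim : Tendsto (fun n : ℕ => D * (3 / 5 : ℝ) ^ n) atTop (nhds (D * 0)) :=
    (tendsto_pow_atTop_nhds_zero_of_lt_one (by norm_num) (by norm_num)).const_mul D
  rw [mul_zero] at hlim
  have h0 := ge_of_tendsto' hlim fun n => key n v D hD
  exact sub_eq_zero.1 (abs_nonpos_iff.1 h0)

lemma IsSG.harm_f (hK : IsSG K) (v : Fin 3 → ℝ) (i : Fin 3) {x : ℂ} (hx : x ∈ K) :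
    harm K v (f i x) = harm K (harmStep i v) x := by
  rw [harm_eq_branch]
  obtain h | ⟨j, -, rfl, h⟩ := hK.branch_f i hx
  · rw [h]
  · rw [h]
    simp only
    rw [hK.harm_p, hK.harm_p, harmStep_comm]

lemma sq_harm_sub_le (v : Fin 3 → ℝ) (x y : ℂ) :
    (harm K v x - harm K v y) ^ 2 ≤ vertexEnergy v := by
  obtain ⟨a, ha⟩ := Finite.exists_min v
  obtain ⟨b, hb⟩ := Finite.exists_max v
  refine le_trans (sq_le_sq' ?_ ?_) (sq_sub_le_vertexEnergy v b a)
  · linarith [le_harm (K := K) ha x, harm_le (K := K) hb y]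
  · linarith [le_harm (K := K) ha y, harm_le (K := K) hb x]

end Harmonic

section EnergyDecay

variable {K : Set ℂ}

lemma sum_words_succ (n : ℕ) (e : List (Fin 3) → ℝ) :
    ∑ w : Fin (n + 1) → Fin 3, e (List.ofFn w) =
      ∑ i : Fin 3, ∑ w : Fin n → Fin 3, e (i :: List.ofFn w) := by
  rw [← (Fin.consEquiv fun _ => Fin 3).sum_comp, Fintype.sum_prod_type]
  simp [Fin.consEquiv, List.ofFn_succ]

/-- `u` is bounded on `K`, and the squares of its oscillations on the cells of level `n` are
bounded by quantities whose sum decays like `(3 / 5) ^ n`. -/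
def EnergyDecay (K : Set ℂ) (u : ℂ → ℝ) : Prop :=
  ∃ (e : List (Fin 3) → ℝ) (B C : ℝ), (∀ x ∈ K, |u x| ≤ B) ∧
    (∀ w, ∀ x ∈ K, ∀ y ∈ K, (u (fwl w x) - u (fwl w y)) ^ 2 ≤ e w) ∧
    ∀ n : ℕ, ∑ w : Fin n → Fin 3, e (List.ofFn w) ≤ C * (3 / 5) ^ n

/-- The graph energy of the vertex values on the cell of the word `w` of the harmonic function
with vertex values `v`. -/
def cellEnergy : (Fin 3 → ℝ) → List (Fin 3) → ℝ
  | v, [] => vertexEnergy v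
  | v, i :: w => cellEnergy (harmStep i v) w

lemma sum_cellEnergy (n : ℕ) (v : Fin 3 → ℝ) :
    ∑ w : Fin n → Fin 3, cellEnergy v (List.ofFn w) = vertexEnergy v * (3 / 5) ^ n := by
  induction n generalizing v with
  | zero => simp [cellEnergy]
  | succ n ih =>
    rw [sum_words_succ]
    simp only [cellEnergy, ih]
    rw [← Finset.sum_mul, sum_vertexEnergy_harmStep]
    ring

lemma IsSG.fwl_mem (hK : IsSG K) (w : List (Fin 3)) {x : ℂ} (hx : x ∈ K) : fwl w x ∈ K := by
  induction w with
  | nil => exact hx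
  | cons i w ih => exact hK.f_mem i ih

lemma continuous_fwl (w : List (Fin 3)) : Continuous (fwl w) := by
  induction w with
  | nil => exact continuous_id
  | cons i w ih => exact (continuous_f i).comp ih

lemma IsSG.exists_word (hK : IsSG K) (n : ℕ) {x : ℂ} (hx : x ∈ K) :
    ∃ w : Fin n → Fin 3, x ∈ Kw K w := by
  induction n generalizing x with
  | zero => exact ⟨Fin.elim0, x, hx, by simp [fw, fwl]⟩
  | succ n ih =>
    obtain ⟨⟨i, y⟩, hy, rfl⟩ := hK.exists_preimage hx
    obtain ⟨w, z, hz, rfl⟩ := ih hy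
    exact ⟨Fin.cons i w, z, hz, by simp [fw, fwl, List.ofFn_succ]⟩

lemma IsSG.energyDecay_harm (hK : IsSG K) (v : Fin 3 → ℝ) : EnergyDecay K (harm K v) := by
  obtain ⟨a, ha⟩ := Finite.exists_min v
  obtain ⟨b, hb⟩ := Finite.exists_max v
  refine ⟨cellEnergy v, max (v b) (-v a), vertexEnergy v, fun x _ => ?_, fun w => ?_,
    fun n => (sum_cellEnergy n v).le⟩
  · refine abs_le'.2 ⟨(harm_le hb x).trans (le_max_left _ _), ?_⟩
    exact (neg_le_neg (le_harm ha x)).trans (le_max_right _ _)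
  · clear ha hb
    induction w generalizing v with
    | nil => exact fun x _ y _ => sq_harm_sub_le v x y
    | cons i w ih =>
      intro x hx y hy
      simp only [fwl, Function.comp_apply]
      rw [hK.harm_f v i (hK.fwl_mem w hx), hK.harm_f v i (hK.fwl_mem w hy)]
      exact ih _ x hx y hy

lemma IsSG.energyDecay_of_comp (hK : IsSG K) {u : ℂ → ℝ}
    (h : ∀ i, EnergyDecay K (u ∘ f i)) : EnergyDecay K u := by
  choose e B C hB he hC using h
  obtain ⟨b, hb⟩ := Finite.exists_max B
  have hub : ∀ x ∈ K, |u x| ≤ B b := by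
    intro x hx
    obtain ⟨⟨i, y⟩, hy, rfl⟩ := hK.exists_preimage hx
    exact (hB i y hy).trans (hb i)
  let e' : List (Fin 3) → ℝ := fun w =>
    match w with
    | [] => (2 * B b) ^ 2
    | i :: w => e i w
  refine ⟨e', B b, max ((2 * B b) ^ 2) (5 / 3 * ∑ i, C i), hub, ?_, ?_⟩
  · intro w x hx y hy
    cases w with
    | nil =>
      have h1 := abs_le.1 (hub x hx)
      have h2 := abs_le.1 (hub y hy)
      exact sq_le_sq' (by simp only [fwl, id]; linarith) (by simp only [fwl, id]; linarith)
    | cons i w => exact he i w x hx y hy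
  · intro n
    cases n with
    | zero => simp [e']
    | succ n =>
      rw [sum_words_succ]
      calc ∑ i, ∑ w : Fin n → Fin 3, e i (List.ofFn w)
          ≤ ∑ i, C i * (3 / 5) ^ n := Finset.sum_le_sum fun i _ => hC i n
        _ = (5 / 3 * ∑ i, C i) * (3 / 5) ^ (n + 1) := by
          rw [← Finset.sum_mul]
          ring
        _ ≤ _ := by
          gcongr
          exact le_max_right _ _

lemma IsSG.isClosed_Kw (hK : IsSG K) {n : ℕ} (w : Fin n → Fin 3) : IsClosed (Kw K w) :=
  (hK.2.1.image (continuous_fwl _)).isClosed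

lemma IsSG.continuousOn_of_energyDecay (hK : IsSG K) {u : ℂ → ℝ} (hu : EnergyDecay K u) :
    ContinuousOn u K := by
  obtain ⟨e, B, C, -, he, hC⟩ := hu
  have e_nonneg : ∀ w, 0 ≤ e w := fun w =>
    (sq_nonneg _).trans (he w _ (hK.p_mem 0) _ (hK.p_mem 0))
  intro x hx
  rw [ContinuousWithinAt, Metric.tendsto_nhds]
  intro ε hε
  have hlim : Tendsto (fun n : ℕ => C * (3 / 5 : ℝ) ^ n) atTop (nhds (C * 0)) :=
    (tendsto_pow_atTop_nhds_zero_of_lt_one (by norm_num) (by norm_num)).const_mul C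
  rw [mul_zero] at hlim
  obtain ⟨n, hn⟩ := (hlim.eventually (gt_mem_nhds (pow_pos hε 2))).exists
  have hw : ∀ w : Fin n → Fin 3, ∀ᶠ y in nhdsWithin x K, y ∈ Kw K w → dist (u y) (u x) < ε := by
    intro w
    by_cases hxw : x ∈ Kw K w
    · obtain ⟨x', hx', rfl⟩ := hxw
      refine Eventually.of_forall ?_
      rintro _ ⟨y', hy', rfl⟩
      rw [Real.dist_eq]
      refine abs_lt_of_sq_lt_sq ?_ hε.le
      calc _ ≤ e (List.ofFn w) := he _ y' hy' x' hx'
        _ ≤ ∑ w : Fin n → Fin 3, e (List.ofFn w) :=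
          Finset.single_le_sum (f := fun w : Fin n → Fin 3 => e (List.ofFn w))
            (fun w _ => e_nonneg _) (Finset.mem_univ w)
        _ ≤ _ := hC n
        _ < _ := hn
    · have h : ∀ᶠ y in nhds x, y ∉ Kw K w := (hK.isClosed_Kw w).isOpen_compl.mem_nhds hxw
      exact (h.filter_mono nhdsWithin_le_nhds).mono fun y hy hy' => absurd hy' hy
  filter_upwards [eventually_all.2 hw, self_mem_nhdsWithin] with y hy hyK
  obtain ⟨w, hw⟩ := hK.exists_word n hyK
  exact hy w hw

/-- The function that interpolates `g` at the vertices of the cells of level `m` and is harmonic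
inside each of these cells. -/
def interp (K : Set ℂ) : ℕ → (ℂ → ℝ) → ℂ → ℝ
  | 0, g, x => harm K (fun j => g (p j)) x
  | m + 1, g, x => interp K m (g ∘ f (branch K x).1) (branch K x).2

lemma IsSG.interp_p (hK : IsSG K) (m : ℕ) (g : ℂ → ℝ) (i : Fin 3) :
    interp K m g (p i) = g (p i) := by
  induction m generalizing g with
  | zero => exact hK.harm_p _ i
  | succ m ih => rw [interp, hK.branch_p, ih, Function.comp_apply, f_p_self]

lemma IsSG.interp_succ_f (hK : IsSG K) (m : ℕ) (g : ℂ → ℝ) (i : Fin 3) {x : ℂ} (hx : x ∈ K) :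
    interp K (m + 1) g (f i x) = interp K m (g ∘ f i) x := by
  rw [interp]
  obtain h | ⟨j, -, rfl, h⟩ := hK.branch_f i hx
  · rw [h]
  · rw [h]
    simp only
    rw [hK.interp_p, hK.interp_p, Function.comp_apply, Function.comp_apply, f_p_comm]

lemma EnergyDecay.congr (hK : IsSG K) {u v : ℂ → ℝ} (hu : EnergyDecay K u)
    (h : ∀ x ∈ K, u x = v x) : EnergyDecay K v := by
  obtain ⟨e, B, C, hB, he, hC⟩ := hu
  refine ⟨e, B, C, fun x hx => ?_, fun w x hx y hy => ?_, hC⟩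
  · rw [← h x hx]
    exact hB x hx
  · rw [← h _ (hK.fwl_mem w hx), ← h _ (hK.fwl_mem w hy)]
    exact he w x hx y hy

lemma IsSG.energyDecay_interp (hK : IsSG K) (m : ℕ) (g : ℂ → ℝ) :
    EnergyDecay K (interp K m g) := by
  induction m generalizing g with
  | zero => exact hK.energyDecay_harm _
  | succ m ih =>
    exact hK.energyDecay_of_comp fun i =>
      (ih (g ∘ f i)).congr hK fun x hx => (hK.interp_succ_f m g i hx).symm

lemma IsSG.abs_interp_sub_le (hK : IsSG K) (m : ℕ) {g : ℂ → ℝ} {ε : ℝ}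
    (hg : ∀ y ∈ K, ∀ z ∈ K, dist y z ≤ Metric.diam K / 2 ^ m → |g y - g z| ≤ ε)
    {x : ℂ} (hx : x ∈ K) : |interp K m g x - g x| ≤ ε := by
  induction m generalizing g x with
  | zero =>
    have h : ∀ j, |g (p j) - g x| ≤ ε := fun j => by
      refine hg _ (hK.p_mem j) _ hx ?_
      rw [pow_zero, div_one]
      exact Metric.dist_le_diam_of_mem hK.2.1.isBounded (hK.p_mem j) hx
    rw [interp, abs_le]
    constructor
    · have := le_harm (K := K) (v := fun j => g (p j)) (a := g x - ε)
        (fun j => by linarith [(abs_le.1 (h j)).1]) x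
      linarith
    · have := harm_le (K := K) (v := fun j => g (p j)) (b := g x + ε)
        (fun j => by linarith [(abs_le.1 (h j)).2]) x
      linarith
  | succ m ih =>
    have := ih (g := g ∘ f (branch K x).1) ?_ (hK.branch_mem hx)
    · rwa [Function.comp_apply, hK.f_branch hx] at this
    · intro y hy z hz hyz
      refine hg _ (hK.f_mem _ hy) _ (hK.f_mem _ hz) ?_
      rw [dist_f, pow_succ, ← div_div]
      gcongr

lemma IsSG.exists_energyDecay_approx (hK : IsSG K) {g : ℂ → ℝ} (hg : ContinuousOn g K)
    {ε : ℝ} (hε : 0 < ε) : ∃ u, EnergyDecay K u ∧ ∀ x ∈ K, |u x - g x| ≤ ε := by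
  obtain ⟨δ, hδ, h⟩ := Metric.uniformContinuousOn_iff.1
    (hK.2.1.uniformContinuousOn_of_continuous hg) ε hε
  have hlim : Tendsto (fun m : ℕ => Metric.diam K / (2 : ℝ) ^ m) atTop (nhds 0) :=
    tendsto_const_nhds.div_atTop (tendsto_pow_atTop_atTop_of_one_lt (by norm_num))
  obtain ⟨m, hm⟩ := (hlim.eventually (gt_mem_nhds hδ)).exists
  exact ⟨interp K m g, hK.energyDecay_interp m g, fun x hx =>
    hK.abs_interp_sub_le m (fun y hy z hz hyz => (h y hy z hz (hyz.trans_lt hm)).le) hx⟩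

end EnergyDecay

section Adjacency

variable {K : Set ℂ}

/-- The binary number whose `k`-th digit from the left is `1` when the `k`-th letter is `c`. -/
def wordCoord (c : Fin 3) : List (Fin 3) → ℕ
  | [] => 0
  | i :: w => wordCoord c w + if i = c then 2 ^ w.length else 0

lemma wordCoord_lt (c : Fin 3) (w : List (Fin 3)) : wordCoord c w < 2 ^ w.length := by
  induction w with
  | nil => simp [wordCoord]
  | cons i w ih =>
    rw [wordCoord, List.length_cons, pow_succ]
    split_ifs <;> omega

lemma eq_of_wordCoord_eq {w w' : List (Fin 3)} (hl : w.length = w'.length)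
    (h1 : wordCoord 1 w = wordCoord 1 w') (h2 : wordCoord 2 w = wordCoord 2 w') : w = w' := by
  induction w generalizing w' with
  | nil => exact (List.length_eq_zero_iff.1 hl.symm).symm
  | cons i w ih =>
    cases w' with
    | nil => simp at hl
    | cons j w' =>
      simp only [List.length_cons, add_left_inj] at hl
      have a1 := wordCoord_lt 1 w
      have a2 := wordCoord_lt 2 w
      have b1 := wordCoord_lt 1 w'
      have b2 := wordCoord_lt 2 w'
      simp only [wordCoord] at h1 h2
      rw [← hl] at b1 b2 h1 h2
      have hij : i = j ∧ wordCoord 1 w = wordCoord 1 w' ∧ wordCoord 2 w = wordCoord 2 w' := by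
        fin_cases i <;> fin_cases j <;> simp at h1 h2 ⊢ <;> omega
      rw [hij.1, ih hl hij.2.1 hij.2.2]

lemma coordOne_fwl (w : List (Fin 3)) (x : ℂ) :
    2 ^ w.length * coordOne (fwl w x) = coordOne x + wordCoord 1 w := by
  induction w with
  | nil => simp [fwl, wordCoord]
  | cons i w ih =>
    simp only [fwl, Function.comp_apply, coordOne_f, coordOne_p, wordCoord, List.length_cons]
    push_cast
    split_ifs
    · linear_combination ih
    · linear_combination ih

lemma coordTwo_fwl (w : List (Fin 3)) (x : ℂ) :
    2 ^ w.length * coordTwo (fwl w x) = coordTwo x + wordCoord 2 w := by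
  induction w with
  | nil => simp [fwl, wordCoord]
  | cons i w ih =>
    simp only [fwl, Function.comp_apply, coordTwo_f, coordTwo_p, wordCoord, List.length_cons]
    push_cast
    split_ifs
    · linear_combination ih
    · linear_combination ih

lemma Adj.symm {n : ℕ} {w w' : Fin n → Fin 3} (h : Adj K w w') : Adj K w' w :=
  ⟨h.1.symm, by rw [inter_comm]; exact h.2⟩

lemma int_sub_mem_Icc {a b : ℕ} {s t : ℝ} (hs : 0 ≤ s) (hs' : s ≤ 1) (ht : 0 ≤ t) (ht' : t ≤ 1)
    (h : s + a = t + b) : (b : ℤ) - a ∈ Finset.Icc (-1 : ℤ) 1 := by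
  rw [Finset.mem_Icc]
  have h1 : (-1 : ℝ) ≤ b - a := by linarith
  have h2 : (b : ℝ) - a ≤ 1 := by linarith
  exact ⟨by exact_mod_cast h1, by exact_mod_cast h2⟩

lemma IsSG.card_adj_le (hK : IsSG K) {n : ℕ} (w : Fin n → Fin 3) :
    (Finset.univ.filter fun w' => Adj K w w').card ≤ 9 := by
  let φ : (Fin n → Fin 3) → ℤ × ℤ := fun w' =>
    ((wordCoord 1 (List.ofFn w') : ℤ) - wordCoord 1 (List.ofFn w),
      (wordCoord 2 (List.ofFn w') : ℤ) - wordCoord 2 (List.ofFn w))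
  have hcard : (Finset.Icc (-1 : ℤ) 1 ×ˢ Finset.Icc (-1 : ℤ) 1).card = 9 := by rfl
  rw [← hcard]
  refine Finset.card_le_card_of_injOn φ ?_ ?_
  · intro w' hw'
    obtain ⟨-, z, ⟨x, hx, hxz⟩, ⟨y, hy, hyz⟩⟩ := (Finset.mem_filter.1 hw').2
    have x1 := hK.coordOne_nonneg hx
    have x2 := hK.coordTwo_nonneg hx
    have x3 := hK.coord_add_le_one hx
    have y1 := hK.coordOne_nonneg hy
    have y2 := hK.coordTwo_nonneg hy
    have y3 := hK.coord_add_le_one hy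
    have e1 := coordOne_fwl (List.ofFn w) x
    have e1' := coordOne_fwl (List.ofFn w') y
    have e2 := coordTwo_fwl (List.ofFn w) x
    have e2' := coordTwo_fwl (List.ofFn w') y
    rw [← fw, hxz, List.length_ofFn] at e1 e2
    rw [← fw, hyz, List.length_ofFn] at e1' e2'
    refine Finset.mem_product.2 ⟨?_, ?_⟩
    · exact int_sub_mem_Icc x1 (by linarith) y1 (by linarith) (e1.symm.trans e1')
    · exact int_sub_mem_Icc x2 (by linarith) y2 (by linarith) (e2.symm.trans e2')
  · intro w1 _ w2 _ h
    simp only [φ, Prod.mk.injEq, sub_left_inj, Nat.cast_inj] at h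
    exact List.ofFn_injective (eq_of_wordCoord_eq (by simp) h.1 h.2)

end Adjacency

section Energy

variable {K : Set ℂ}

lemma nu_eq_zero_or_isProbabilityMeasure (K : Set ℂ) :
    nu K = 0 ∨ IsProbabilityMeasure (nu K) := by
  unfold nu
  by_cases h0 : (Measure.hausdorffMeasure alpha : Measure ℂ) K = 0
  · left
    rw [Measure.restrict_eq_zero.2 h0, smul_zero]
  by_cases ht : (Measure.hausdorffMeasure alpha : Measure ℂ) K = ⊤
  · left
    rw [ht, ENNReal.inv_top, zero_smul]
  · right
    refine ⟨?_⟩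
    rw [Measure.smul_apply, Measure.restrict_apply_univ, smul_eq_mul, ENNReal.inv_mul_cancel h0 ht]

lemma IsSG.ae_mem_nu (hK : IsSG K) : ∀ᵐ x ∂nu K, x ∈ K :=
  Measure.ae_smul_measure (ae_restrict_mem hK.2.1.measurableSet) _

lemma IsSG.abs_P_sub_le (hK : IsSG K) [IsProbabilityMeasure (nu K)] {u : ℂ → ℝ}
    (hu : ContinuousOn u K) {n : ℕ} (w : Fin n → Fin 3) {z c : ℝ}
    (hc : ∀ x ∈ K, |u (fw w x) - z| ≤ c) : |P K u w - z| ≤ c := by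
  have hcont : ContinuousOn (fun x => u (fw w x) - z) K :=
    (hu.comp (continuous_fwl _).continuousOn fun x hx => hK.fwl_mem _ hx).sub continuousOn_const
  have hae : ∀ᵐ x ∂nu K, ‖u (fw w x) - z‖ ≤ c := hK.ae_mem_nu.mono hc
  have int_sub : Integrable (fun x => u (fw w x) - z) (nu K) := by
    refine Integrable.of_bound ?_ c hae
    exact (hcont.aestronglyMeasurable hK.2.1.measurableSet).smul_measure _
  have h := norm_integral_le_of_norm_le_const hae
  have int_fw : Integrable (fun x => u (fw w x)) (nu K) :=
    (int_sub.add (integrable_const z)).congr (ae_of_all _ fun x => sub_add_cancel _ _)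
  rw [integral_sub int_fw (integrable_const z)] at h
  simpa [P] using h

lemma IsSG.sq_P_sub_P_le (hK : IsSG K) {u : ℂ → ℝ} (hu : ContinuousOn u K)
    {e : List (Fin 3) → ℝ}
    (he : ∀ w, ∀ x ∈ K, ∀ y ∈ K, (u (fwl w x) - u (fwl w y)) ^ 2 ≤ e w)
    {n : ℕ} {w w' : Fin n → Fin 3} (h : Adj K w w') :
    (P K u w - P K u w') ^ 2 ≤ 2 * (e (List.ofFn w) + e (List.ofFn w')) := by
  have e_nonneg : ∀ w, 0 ≤ e w := fun w =>
    (sq_nonneg _).trans (he w _ (hK.p_mem 0) _ (hK.p_mem 0))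
  have hw := e_nonneg (List.ofFn w)
  have hw' := e_nonneg (List.ofFn w')
  obtain h0 | hp := nu_eq_zero_or_isProbabilityMeasure K
  · simp only [P, h0, integral_zero_measure, sub_self]
    rw [zero_pow two_ne_zero]
    positivity
  · obtain ⟨-, z, ⟨x, hx, hxz⟩, ⟨y, hy, hyz⟩⟩ := h
    have h1 := hK.abs_P_sub_le hu w (z := u z) (c := Real.sqrt (e (List.ofFn w)))
      (fun t ht => by
        rw [← hxz]
        exact Real.abs_le_sqrt (he _ t ht x hx))
    have h2 := hK.abs_P_sub_le hu w' (z := u z) (c := Real.sqrt (e (List.ofFn w')))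
      (fun t ht => by
        rw [← hyz]
        exact Real.abs_le_sqrt (he _ t ht y hy))
    have s1 := Real.sq_sqrt hw ▸ sq_le_sq' (abs_le.1 h1).1 (abs_le.1 h1).2
    have s2 := Real.sq_sqrt hw' ▸ sq_le_sq' (abs_le.1 h2).1 (abs_le.1 h2).2
    nlinarith [sq_nonneg (P K u w - u z + (P K u w' - u z))]

lemma IsSG.A_le (hK : IsSG K) {u : ℂ → ℝ} (hu : ContinuousOn u K)
    {e : List (Fin 3) → ℝ}
    (he : ∀ w, ∀ x ∈ K, ∀ y ∈ K, (u (fwl w x) - u (fwl w y)) ^ 2 ≤ e w) (n : ℕ) :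
    A K n u ≤ 18 * ∑ w : Fin n → Fin 3, e (List.ofFn w) := by
  have e_nonneg : ∀ w, 0 ≤ e w := fun w =>
    (sq_nonneg _).trans (he w _ (hK.p_mem 0) _ (hK.p_mem 0))
  let E : (Fin n → Fin 3) → ℝ := fun w => e (List.ofFn w)
  have hdeg : ∑ w, ∑ w', (if Adj K w w' then E w else 0) ≤ 9 * ∑ w, E w := by
    rw [Finset.mul_sum]
    refine Finset.sum_le_sum fun w _ => ?_
    rw [← Finset.sum_filter, Finset.sum_const, nsmul_eq_mul]
    refine mul_le_mul_of_nonneg_right ?_ (e_nonneg _)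
    exact_mod_cast hK.card_adj_le w
  have hswap : ∑ w, ∑ w', (if Adj K w w' then E w' else 0) =
      ∑ w, ∑ w', (if Adj K w w' then E w else 0) := by
    rw [Finset.sum_comm]
    refine Finset.sum_congr rfl fun w _ => Finset.sum_congr rfl fun w' _ => ?_
    exact if_congr ⟨Adj.symm, Adj.symm⟩ rfl rfl
  have hle : ∑ w : Fin n → Fin 3, ∑ w' : Fin n → Fin 3,
      (if Adj K w w' then (P K u w - P K u w') ^ 2 else 0) ≤
      2 * (∑ w, ∑ w', (if Adj K w w' then E w else 0) +
        ∑ w, ∑ w', (if Adj K w w' then E w' else 0)) := by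
    rw [← Finset.sum_add_distrib, Finset.mul_sum]
    refine Finset.sum_le_sum fun w _ => ?_
    rw [← Finset.sum_add_distrib, Finset.mul_sum]
    refine Finset.sum_le_sum fun w' _ => ?_
    split_ifs with h
    · exact hK.sq_P_sub_P_le hu he h
    · simp
  unfold A
  change _ ≤ 18 * ∑ w, E w
  linarith

lemma two_rpow_sub_mul_lt_one {β : ℝ} (h : β < betastar) :
    (2 : ℝ) ^ (β - alpha) * (3 / 5) < 1 := by
  have h3 : (2 : ℝ) ^ alpha = 3 := by
    rw [alpha, Real.log_div_log, Real.rpow_logb] <;> norm_num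
  have h5 : (2 : ℝ) ^ betastar = 5 := by
    rw [betastar, Real.log_div_log, Real.rpow_logb] <;> norm_num
  have hlt : (2 : ℝ) ^ β < 5 := h5 ▸ Real.rpow_lt_rpow_of_exponent_lt one_lt_two h
  rw [Real.rpow_sub two_pos, h3]
  linarith

lemma IsSG.EE_lt_top (hK : IsSG K) {β : ℝ} (hβ : β < betastar) {u : ℂ → ℝ}
    (hu : EnergyDecay K u) : EE K β u < ⊤ := by
  have hcont := hK.continuousOn_of_energyDecay hu
  obtain ⟨e, B, C, -, he, hC⟩ := hu
  set r : ℝ := (2 : ℝ) ^ (β - alpha) * (3 / 5) with hr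
  have hr0 : 0 ≤ r := by positivity
  have hr1 : r < 1 := two_rpow_sub_mul_lt_one hβ
  have hsum : Summable fun n : ℕ => 18 * C * r * r ^ n :=
    (summable_geometric_of_lt_one hr0 hr1).mul_left _
  refine lt_of_le_of_lt (ENNReal.tsum_le_tsum fun n => ENNReal.ofReal_le_ofReal ?_)
    hsum.tsum_ofReal_lt_top
  have hA : A K (n + 1) u ≤ 18 * (C * (3 / 5) ^ (n + 1)) :=
    (hK.A_le hcont he (n + 1)).trans (by gcongr; exact hC (n + 1))
  have hpow : (2 : ℝ) ^ ((β - alpha) * ((n : ℝ) + 1)) = ((2 : ℝ) ^ (β - alpha)) ^ (n + 1) := by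
    rw [Real.rpow_mul two_pos.le, ← Real.rpow_natCast]
    push_cast
    rfl
  calc _ ≤ ((2 : ℝ) ^ (β - alpha)) ^ (n + 1) * (18 * (C * (3 / 5) ^ (n + 1))) := by
        rw [hpow]
        gcongr
    _ = 18 * C * r * r ^ n := by
        rw [hr]
        ring

end Energy

/-- The continuous functions on `K` of finite `ℰ_β`-energy are uniformly dense in `C(K)`. -/
theorem statement14 (K : Set ℂ) (hK : IsSG K) (β : ℝ)
    (h1 : alpha < β) (h2 : β < betastar) :
    ∀ g : ℂ → ℝ, ContinuousOn g K → ∀ ε : ℝ, 0 < ε →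
      ∃ u : ℂ → ℝ, ContinuousOn u K ∧ EE K β u < ⊤ ∧ ∀ x ∈ K, |u x - g x| ≤ ε := by
  intro g hg ε hε
  obtain ⟨u, hu, hug⟩ := hK.exists_energyDecay_approx hg hε
  exact ⟨u, hK.continuousOn_of_energyDecay hu, hK.EE_lt_top h2 hu, hug⟩

end SG
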